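/- Let d ≥ 2, let 0 < r < R, and let Ω = {x ∈ ℝ^d : r ≤ |x| ≤ R} be the closed annulus. Let u : ℝ^d → ℂ be continuously differentiable. Then for every ε > 0 one has ∫_Ω |u(x)|² dx ≤ (1+ε)(R/r)^{d−1}·((R−r)²/π²)·∫_Ω |∇u(x)|² dx + (1+ε⁻¹)·R^{d−1}·(R−r)·(∫_{S^{d−1}} |u(r·w)|² dσ(w) + ∫_{S^{d−1}} |u(R·w)|² dσ(w)), where σ denotes the (d−1)-dimensional surface (Hausdorff) measure on the unit sphere S^{d−1} ⊂ ℝ^d. -/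

import Mathlib

open MeasureTheory Filter Real

theorem tan_le_of_lt_one {s : ℝ} (hs : 0 < s) (hs1 : s < 1) :
    tan (π / 2 * s) * (1 - s ^ 2) ≤ π * s := by
  have hπ := pi_pos
  have hc : 1 - s ≤ cos (π / 2 * s) := by
    have h := mul_le_sin (x := π / 2 * (1 - s)) (by nlinarith) (by nlinarith)
    have e : π / 2 * (1 - s) = π / 2 - π / 2 * s := by ring
    rw [e, sin_pi_div_two_sub, ← e] at h
    calc 1 - s = 2 / π * (π / 2 * (1 - s)) := by field_simp
      _ ≤ _ := h
  have hc0 : 0 < cos (π / 2 * s) := by linarith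
  have hsin : sin (π / 2 * s) ≤ π / 2 * s := sin_le (by positivity)
  rw [tan_eq_sin_div_cos, div_mul_eq_mul_div, div_le_iff₀ hc0]
  have h1 : sin (π / 2 * s) * (1 - s ^ 2) ≤ π / 2 * s * (1 - s ^ 2) :=
    mul_le_mul_of_nonneg_right hsin (by nlinarith)
  have h2 : π * s * (1 - s) ≤ π * s * cos (π / 2 * s) :=
    mul_le_mul_of_nonneg_left hc (by positivity)
  have h3 : 0 ≤ π / 2 * s * (1 - s) * (1 - s) := by
    have : 0 ≤ 1 - s := by linarith
    positivity
  nlinarith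

section OneDim

variable {F : Type*} [NormedAddCommGroup F] [InnerProductSpace ℝ F]

theorem sq_mul_integral_norm_sq_le {a b k : ℝ} (hab : a < b) (hk : 0 < k)
    (hkab : k * (b - a) < π) {f f' : ℝ → F} (hf : ∀ x, HasDerivAt f (f' x) x)
    (hf' : Continuous f') :
    k ^ 2 * ∫ x in a..b, ‖f x‖ ^ 2 ≤ (∫ x in a..b, ‖f' x‖ ^ 2) +
      k * tan (k * ((b - a) / 2)) * (‖f a‖ ^ 2 + ‖f b‖ ^ 2) := by
  have hfc : Continuous f := continuous_iff_continuousAt.2 fun x => (hf x).continuousAt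
  set m := (a + b) / 2 with hm
  set p : ℝ → ℝ := fun x => k * tan (k * (x - m)) with hp
  have hcos : ∀ x ∈ Set.uIcc a b, cos (k * (x - m)) ≠ 0 := by
    intro x hx
    rw [Set.uIcc_of_le hab.le] at hx
    have h1 : k * a ≤ k * x := mul_le_mul_of_nonneg_left hx.1 hk.le
    have h2 : k * x ≤ k * b := mul_le_mul_of_nonneg_left hx.2 hk.le
    refine (cos_pos_of_mem_Ioo ⟨?_, ?_⟩).ne' <;> rw [hm] <;> nlinarith
  have hpd : ∀ x ∈ Set.uIcc a b, HasDerivAt p (k ^ 2 + p x ^ 2) x := by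
    intro x hx
    have h1 : HasDerivAt (fun x : ℝ => k * (x - m)) k x := by
      simpa using ((hasDerivAt_id x).sub_const m).const_mul k
    have h2 := ((hasDerivAt_tan (hcos x hx)).comp x h1).const_mul k
    have h3 : k ^ 2 + p x ^ 2 = k * (1 / cos (k * (x - m)) ^ 2 * k) := by
      have := hcos x hx
      simp only [hp, tan_eq_sin_div_cos]
      field_simp
      rw [cos_sq_add_sin_sq]
    rw [h3]
    exact h2
  have hpc : ContinuousOn p (Set.uIcc a b) := fun x hx => (hpd x hx).continuousAt.continuousWithinAt
  set G' : ℝ → ℝ := fun x =>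
    (k ^ 2 + p x ^ 2) * ‖f x‖ ^ 2 + p x * (2 * inner ℝ (f x) (f' x)) with hG'
  have hGd : ∀ x ∈ Set.uIcc a b, HasDerivAt (fun x => p x * ‖f x‖ ^ 2) (G' x) x :=
    fun x hx => (hpd x hx).mul (hf x).norm_sq
  have hG'c : ContinuousOn G' (Set.uIcc a b) := by
    have hi : ContinuousOn (fun x => inner ℝ (f x) (f' x)) (Set.uIcc a b) :=
      (hfc.inner hf').continuousOn
    have hn : ContinuousOn (fun x => ‖f x‖ ^ 2) (Set.uIcc a b) := (hfc.norm.pow 2).continuousOn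
    exact ((continuousOn_const.add (hpc.pow 2)).mul hn).add (hpc.mul (continuousOn_const.mul hi))
  have hFTC := intervalIntegral.integral_eq_sub_of_hasDerivAt hGd hG'c.intervalIntegrable
  have hpa : p a = -(k * tan (k * ((b - a) / 2))) := by
    rw [← mul_neg, ← tan_neg, hp, hm]; ring_nf
  have hpb : p b = k * tan (k * ((b - a) / 2)) := by
    rw [hp, hm]; ring_nf
  have hi1 : IntervalIntegrable (fun x => ‖f x‖ ^ 2) volume a b :=
    (hfc.norm.pow 2).intervalIntegrable _ _
  have hi2 : IntervalIntegrable (fun x => ‖f' x‖ ^ 2) volume a b :=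
    (hf'.norm.pow 2).intervalIntegrable _ _
  have key : ∫ x in a..b, k ^ 2 * ‖f x‖ ^ 2 ≤ ∫ x in a..b, (‖f' x‖ ^ 2 + G' x) := by
    refine intervalIntegral.integral_mono_on hab.le (hi1.const_mul _)
      (hi2.add hG'c.intervalIntegrable) fun x _ => ?_
    have h := sq_nonneg ‖f' x + p x • f x‖
    rw [norm_add_sq_real, norm_smul, mul_pow, inner_smul_right, real_inner_comm] at h
    simp only [norm_eq_abs, sq_abs] at h
    simp only [hG']
    linarith
  rw [intervalIntegral.integral_const_mul,
    intervalIntegral.integral_add hi2 hG'c.intervalIntegrable, hFTC, hpa, hpb] at key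
  linarith

theorem integral_norm_sq_le_add {a b ε : ℝ} (hab : a < b) (hε : 0 < ε)
    {f f' : ℝ → F} (hf : ∀ x, HasDerivAt f (f' x) x) (hf' : Continuous f') :
    ∫ x in a..b, ‖f x‖ ^ 2 ≤ (1 + ε) * ((b - a) ^ 2 / π ^ 2) * (∫ x in a..b, ‖f' x‖ ^ 2) +
      (1 + ε⁻¹) * (b - a) * (‖f a‖ ^ 2 + ‖f b‖ ^ 2) := by
  have hπ := pi_pos
  have hL : 0 < b - a := sub_pos.2 hab
  set s : ℝ := (√(1 + ε))⁻¹ with hs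
  have hs0 : 0 < s := by positivity
  have hs2 : s ^ 2 = (1 + ε)⁻¹ := by rw [hs, inv_pow, sq_sqrt (by positivity)]
  have hs1 : s < 1 := by
    have : s ^ 2 < 1 := by rw [hs2]; exact inv_lt_one_of_one_lt₀ (by linarith)
    nlinarith
  have h := sq_mul_integral_norm_sq_le (k := π * s / (b - a)) hab (by positivity)
    (by rw [div_mul_cancel₀ _ hL.ne']; nlinarith) hf hf'
  have ht := tan_le_of_lt_one hs0 hs1
  have e : π * s / (b - a) * ((b - a) / 2) = π / 2 * s := by field_simp
  rw [e] at h
  set I := ∫ x in a..b, ‖f x‖ ^ 2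
  set J := ∫ x in a..b, ‖f' x‖ ^ 2
  set N := ‖f a‖ ^ 2 + ‖f b‖ ^ 2 with hN
  have hN0 : 0 ≤ N := by positivity
  set t := tan (π / 2 * s)
  have e1 : 1 - s ^ 2 = ε / (1 + ε) := by rw [hs2]; field_simp; ring
  rw [e1, mul_div_assoc', div_le_iff₀ (by positivity)] at ht
  have hI : I ≤ (1 + ε) * ((b - a) ^ 2 / π ^ 2) * J + (b - a) * t / (π * s) * N := by
    have h2 := mul_le_mul_of_nonneg_left h
      (show 0 ≤ (b - a) ^ 2 / (π ^ 2 * s ^ 2) by positivity)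
    have l : (b - a) ^ 2 / (π ^ 2 * s ^ 2) * ((π * s / (b - a)) ^ 2 * I) = I := by field_simp
    have r : (b - a) ^ 2 / (π ^ 2 * s ^ 2) * (J + π * s / (b - a) * t * N) =
        (s ^ 2)⁻¹ * ((b - a) ^ 2 / π ^ 2) * J + (b - a) * t / (π * s) * N := by field_simp
    rw [l, r, hs2, inv_inv] at h2
    exact h2
  refine hI.trans ?_
  gcongr
  rw [div_le_iff₀ (by positivity)]
  have : t ≤ (1 + ε⁻¹) * (π * s) := by
    have : (1 + ε⁻¹) * (π * s) = (π * s * (1 + ε)) / ε := by field_simp; ring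
    rw [this, le_div_iff₀ hε]; exact ht
  calc (b - a) * t ≤ (b - a) * ((1 + ε⁻¹) * (π * s)) := by gcongr
    _ = _ := by ring

end OneDim

open scoped Topology Pointwise NNReal ENNReal

theorem volume_prod_cone (n : ℕ) {T : Set (Fin n → ℝ)} (hT : MeasurableSet T) :
    volume {p : ℝ × (Fin n → ℝ) | p.1 ∈ Set.Ioo (0 : ℝ) 1 ∧ p.1⁻¹ • p.2 ∈ T} =
      ((n : ℝ≥0∞) + 1)⁻¹ * volume T := by
  have hS : MeasurableSet {p : ℝ × (Fin n → ℝ) | p.1 ∈ Set.Ioo (0 : ℝ) 1 ∧ p.1⁻¹ • p.2 ∈ T} :=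
    (measurable_fst measurableSet_Ioo).inter ((measurable_fst.inv.smul measurable_snd) hT)
  rw [Measure.volume_eq_prod, Measure.prod_apply hS]
  have h1 : ∀ s : ℝ, volume (Prod.mk s ⁻¹'
      {p : ℝ × (Fin n → ℝ) | p.1 ∈ Set.Ioo (0 : ℝ) 1 ∧ p.1⁻¹ • p.2 ∈ T}) =
      (Set.Ioo (0 : ℝ) 1).indicator (fun s => ENNReal.ofReal (s ^ n) * volume T) s := by
    intro s
    by_cases hs : s ∈ Set.Ioo (0 : ℝ) 1
    · rw [Set.indicator_of_mem hs]
      have : Prod.mk s ⁻¹' {p : ℝ × (Fin n → ℝ) | p.1 ∈ Set.Ioo (0 : ℝ) 1 ∧ p.1⁻¹ • p.2 ∈ T} =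
          (fun x => s⁻¹ • x) ⁻¹' T := by
        ext y; exact and_iff_right hs
      rw [this, Measure.addHaar_preimage_smul _ (inv_ne_zero hs.1.ne'), Module.finrank_fin_fun,
        inv_pow, inv_inv, abs_of_nonneg (pow_nonneg hs.1.le _)]
    · rw [Set.indicator_of_notMem hs]
      have : Prod.mk s ⁻¹' {p : ℝ × (Fin n → ℝ) | p.1 ∈ Set.Ioo (0 : ℝ) 1 ∧ p.1⁻¹ • p.2 ∈ T} =
          ∅ := by
        ext y; simp only [Set.mem_preimage, Set.mem_ofPred_eq, Set.mem_empty_iff_false, iff_false]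
        exact fun h => hs h.1
      rw [this, measure_empty]
  simp_rw [h1]
  rw [lintegral_indicator measurableSet_Ioo, lintegral_mul_const _ (by fun_prop)]
  congr 1
  rw [Measure.restrict_congr_set Ioo_ae_eq_Ioc, ← ofReal_integral_eq_lintegral_ofReal
      (intervalIntegral.intervalIntegrable_pow n).1
      ((ae_restrict_mem measurableSet_Ioc).mono fun x hx => pow_nonneg hx.1.le n),
    ← intervalIntegral.integral_of_le zero_le_one, integral_pow]
  rw [one_pow, zero_pow n.succ_ne_zero, sub_zero, one_div, ENNReal.ofReal_inv_of_pos (by positivity)]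
  congr 1
  rw [ENNReal.ofReal_add (by positivity) zero_le_one]
  simp

section Sphere

variable {E : Type*} [NormedAddCommGroup E] [InnerProductSpace ℝ E] {n : ℕ}

/-- Central projection onto the hyperplane tangent to the unit sphere at `b 0`, in the
coordinates of the orthonormal basis `b`. -/
noncomputable def gnomonic (b : OrthonormalBasis (Fin (n + 1)) ℝ E) (x : E) : Fin n → ℝ :=
  fun i => inner ℝ (b i.succ) x * (inner ℝ (b 0) x)⁻¹

theorem gnomonic_self (b : OrthonormalBasis (Fin (n + 1)) ℝ E) : gnomonic b (b 0) = 0 := by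
  ext i
  simp [gnomonic, b.inner_eq_ite, Fin.succ_ne_zero]

theorem gnomonic_smul (b : OrthonormalBasis (Fin (n + 1)) ℝ E) {t : ℝ} (ht : t ≠ 0) (x : E) :
    gnomonic b (t • x) = gnomonic b x := by
  ext i
  simp only [gnomonic, inner_smul_right]
  field_simp

theorem hasStrictFDerivAt_gnomonic (b : OrthonormalBasis (Fin (n + 1)) ℝ E) :
    HasStrictFDerivAt (gnomonic b)
      (ContinuousLinearMap.pi fun i : Fin n => innerSL ℝ (b i.succ)) (b 0) := by
  refine hasStrictFDerivAt_pi.2 fun i => ?_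
  have h1 : HasStrictFDerivAt (fun x => inner ℝ (b i.succ) x) (innerSL ℝ (b i.succ)) (b 0) :=
    (innerSL ℝ (b i.succ)).hasStrictFDerivAt
  have h2 : ContDiffAt ℝ 1 (fun x => (inner ℝ (b 0) x)⁻¹) (b 0) :=
    (contDiff_const.inner ℝ contDiff_id).contDiffAt.inv (by simp)
  have h3 := h1.mul (h2.hasStrictFDerivAt one_ne_zero)
  exact h3.congr_fderiv (by simp [b.inner_eq_ite, Fin.succ_ne_zero])

theorem exists_lipschitzOnWith_gnomonic (b : OrthonormalBasis (Fin (n + 1)) ℝ E) {K : ℝ≥0}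
    (hK : 1 < K) : ∃ s ∈ 𝓝 (b 0), LipschitzOnWith K (gnomonic b) s := by
  refine (hasStrictFDerivAt_gnomonic b).exists_lipschitzOnWith_of_nnnorm_lt K (lt_of_le_of_lt ?_ hK)
  rw [← NNReal.coe_le_coe, coe_nnnorm, NNReal.coe_one]
  refine ContinuousLinearMap.opNorm_le_bound _ zero_le_one fun x => ?_
  rw [one_mul]
  refine (pi_norm_le_iff_of_nonneg (norm_nonneg _)).2 fun i => ?_
  simpa using norm_inner_le_norm (𝕜 := ℝ) (b i.succ) x

theorem exists_orthonormalBasis_zero_eq [FiniteDimensional ℝ E]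
    (hE : Module.finrank ℝ E = n + 1) {e : E} (he : ‖e‖ = 1) :
    ∃ b : OrthonormalBasis (Fin (n + 1)) ℝ E, b 0 = e := by
  obtain ⟨b, hb⟩ := Orthonormal.exists_orthonormalBasis_extension_of_card_eq (𝕜 := ℝ)
    (ι := Fin (n + 1)) (by simpa using hE) (v := fun _ => e) (s := {0}) (by
      refine ⟨fun _ => he, fun i j hij => absurd (Subsingleton.elim i j) hij⟩)
  exact ⟨b, hb 0 rfl⟩

variable [MeasurableSpace E] [BorelSpace E]

theorem volume_gnomonic_cone [FiniteDimensional ℝ E] (b : OrthonormalBasis (Fin (n + 1)) ℝ E)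
    {T : Set (Fin n → ℝ)} (hT : MeasurableSet T) :
    volume {x : E | inner ℝ (b 0) x ∈ Set.Ioo (0 : ℝ) 1 ∧ gnomonic b x ∈ T} =
      ((n : ℝ≥0∞) + 1)⁻¹ * volume T := by
  rw [← volume_prod_cone n hT]
  have hm := ((volume_preserving_piFinSuccAbove (fun _ : Fin (n + 1) => ℝ) 0).comp
    (PiLp.volume_preserving_ofLp (Fin (n + 1)))).comp b.measurePreserving_repr
  have hS : MeasurableSet {p : ℝ × (Fin n → ℝ) | p.1 ∈ Set.Ioo (0 : ℝ) 1 ∧ p.1⁻¹ • p.2 ∈ T} :=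
    (measurable_fst measurableSet_Ioo).inter ((measurable_fst.inv.smul measurable_snd) hT)
  rw [← hm.measure_preimage hS.nullMeasurableSet]
  congr 1
  ext x
  have hx : ((MeasurableEquiv.piFinSuccAbove (fun _ : Fin (n + 1) => ℝ) 0 ∘ WithLp.ofLp) ∘
      b.repr) x = (inner ℝ (b 0) x, fun i : Fin n => inner ℝ (b i.succ) x) :=
    Prod.ext (b.repr_apply_apply x 0) (funext fun i => b.repr_apply_apply x i.succ)
  have hg : (inner ℝ (b 0) x)⁻¹ • (fun i : Fin n => inner ℝ (b i.succ) x) = gnomonic b x := by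
    ext i
    simp [gnomonic, mul_comm]
  simp only [Set.mem_preimage, hx, Set.mem_ofPred_eq, hg]

theorem exists_nhds_volume_cone_le [FiniteDimensional ℝ E]
    (b : OrthonormalBasis (Fin (n + 1)) ℝ E) {K : ℝ≥0} (hK : 1 < K) :
    ∃ U ∈ 𝓝 (b 0), ∀ A ⊆ U ∩ Metric.sphere (0 : E) 1,
      ((n : ℝ≥0∞) + 1) * volume (Set.Ioo (0 : ℝ) 1 • A) ≤ (K : ℝ≥0∞) ^ n * μH[n] A := by
  obtain ⟨s, hs, hLip⟩ := exists_lipschitzOnWith_gnomonic b hK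
  have hpos : {x : E | 0 < inner ℝ (b 0) x} ∈ 𝓝 (b 0) :=
    (isOpen_lt continuous_const (by fun_prop)).mem_nhds (by simp)
  refine ⟨s ∩ {x : E | 0 < inner ℝ (b 0) x}, inter_mem hs hpos, fun A hA => ?_⟩
  have hsub : Set.Ioo (0 : ℝ) 1 • A ⊆ {x : E | inner ℝ (b 0) x ∈ Set.Ioo (0 : ℝ) 1 ∧
      gnomonic b x ∈ toMeasurable volume (gnomonic b '' A)} := by
    rintro _ ⟨t, ht, w, hw, rfl⟩
    have hw0 : 0 < inner ℝ (b 0) w := (hA hw).1.2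
    have hw1 : inner ℝ (b 0) w ≤ 1 := by
      have h := real_inner_le_norm (b 0) w
      rwa [b.norm_eq_one, mem_sphere_zero_iff_norm.1 (hA hw).2, one_mul] at h
    refine ⟨?_, ?_⟩
    · simp only [inner_smul_right]
      exact ⟨mul_pos ht.1 hw0, by nlinarith [ht.1, ht.2]⟩
    · simp only [gnomonic_smul b ht.1.ne']
      exact subset_toMeasurable _ _ (Set.mem_image_of_mem _ hw)
  calc ((n : ℝ≥0∞) + 1) * volume (Set.Ioo (0 : ℝ) 1 • A)
      ≤ ((n : ℝ≥0∞) + 1) * (((n : ℝ≥0∞) + 1)⁻¹ * volume (gnomonic b '' A)) := by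
        rw [← measure_toMeasurable (gnomonic b '' A),
          ← volume_gnomonic_cone b (measurableSet_toMeasurable _ _)]
        gcongr
    _ = volume (gnomonic b '' A) := by
        rw [← mul_assoc, ENNReal.mul_inv_cancel (by simp) (by simp), one_mul]
    _ = μH[n] (gnomonic b '' A) := by
        rw [← hausdorffMeasure_pi_real, Fintype.card_fin]
    _ ≤ (K : ℝ≥0∞) ^ n * μH[n] A := by
        have h := (hLip.mono (hA.trans (Set.inter_subset_left.trans Set.inter_subset_left))
          ).hausdorffMeasure_image_le (d := n) n.cast_nonneg
        rwa [ENNReal.rpow_natCast] at h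

theorem exists_nhds_hausdorffMeasure_sphere_lt_top [FiniteDimensional ℝ E]
    (b : OrthonormalBasis (Fin (n + 1)) ℝ E) :
    ∃ U ∈ 𝓝 (b 0), μH[n] (U ∩ Metric.sphere (0 : E) 1) < ∞ := by
  set v : (Fin n → ℝ) → E := fun z => b 0 + ∑ i : Fin n, z i • b i.succ with hv
  have hvc : ContDiff ℝ 1 v := by fun_prop
  have hv0 : v 0 = b 0 := by simp [hv]
  have hF : ContDiffAt ℝ 1 (fun z => ‖v z‖⁻¹ • v z) 0 := by
    have h0 : v 0 ≠ 0 := by rw [hv0, ← norm_ne_zero_iff]; simp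
    exact ((hvc.contDiffAt.norm ℝ h0).inv (norm_ne_zero_iff.2 h0)).smul hvc.contDiffAt
  obtain ⟨K, t, ht, hLip⟩ := hF.exists_lipschitzOnWith
  have hcont : ContinuousAt (gnomonic b) (b 0) := (hasStrictFDerivAt_gnomonic b).continuousAt
  have hpos : {x : E | 0 < inner ℝ (b 0) x} ∈ 𝓝 (b 0) :=
    (isOpen_lt continuous_const (by fun_prop)).mem_nhds (by simp)
  have hpre : gnomonic b ⁻¹' (t ∩ Metric.ball 0 1) ∈ 𝓝 (b 0) :=
    hcont (by rw [gnomonic_self]; exact inter_mem ht (Metric.ball_mem_nhds _ one_pos))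
  refine ⟨_, inter_mem hpre hpos, ?_⟩
  have hsub : gnomonic b ⁻¹' (t ∩ Metric.ball 0 1) ∩ {x : E | 0 < inner ℝ (b 0) x} ∩
      Metric.sphere (0 : E) 1 ⊆ (fun z => ‖v z‖⁻¹ • v z) '' (t ∩ Metric.ball 0 1) := by
    rintro w ⟨⟨hw, hw0⟩, hw1⟩
    refine ⟨gnomonic b w, hw, ?_⟩
    have hw0' : 0 < inner ℝ (b 0) w := hw0
    have hvw : v (gnomonic b w) = (inner ℝ (b 0) w)⁻¹ • w := by
      have hw' : w = inner ℝ (b 0) w • b 0 + ∑ i : Fin n, inner ℝ (b i.succ) w • b i.succ := by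
        rw [← Fin.sum_univ_succ (fun i => inner ℝ (b i) w • b i), b.sum_repr']
      have h := congrArg (fun x => (inner ℝ (b 0) w)⁻¹ • x) hw'
      simp only [smul_add, smul_smul, inv_mul_cancel₀ hw0'.ne', one_smul, Finset.smul_sum] at h
      rw [h]
      simp only [hv, gnomonic, mul_comm]
    simp only [hvw, norm_smul, mem_sphere_zero_iff_norm.1 hw1, norm_inv, mul_one, inv_inv,
      Real.norm_of_nonneg hw0'.le, smul_smul, mul_inv_cancel₀ hw0'.ne', one_smul]
  refine (measure_mono hsub).trans_lt (((hLip.mono Set.inter_subset_left).hausdorffMeasure_image_le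
    (d := n) n.cast_nonneg).trans_lt ?_)
  have hvol : (μH[n] : Measure (Fin n → ℝ)) = volume := by
    rw [← hausdorffMeasure_pi_real, Fintype.card_fin]
  rw [hvol, ENNReal.rpow_natCast]
  exact ENNReal.mul_lt_top (ENNReal.pow_lt_top ENNReal.coe_lt_top)
    ((measure_mono Set.inter_subset_right).trans_lt measure_ball_lt_top)

theorem hausdorffMeasure_sphere_lt_top [FiniteDimensional ℝ E]
    (hE : Module.finrank ℝ E = n + 1) : μH[n] (Metric.sphere (0 : E) 1) < ∞ := by
  have := FiniteDimensional.proper_real E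
  refine (isCompact_sphere (0 : E) 1).measure_lt_top_of_nhdsWithin fun e he => ?_
  obtain ⟨b, rfl⟩ := exists_orthonormalBasis_zero_eq hE (mem_sphere_zero_iff_norm.1 he)
  obtain ⟨U, hU, hlt⟩ := exists_nhds_hausdorffMeasure_sphere_lt_top b
  exact ⟨_, inter_mem (mem_nhdsWithin_of_mem_nhds hU) self_mem_nhdsWithin, hlt⟩

theorem toSphere_map_le [FiniteDimensional ℝ E] (hE : Module.finrank ℝ E = n + 1) :
    (volume : Measure E).toSphere.map Subtype.val ≤ μH[n].restrict (Metric.sphere (0 : E) 1) := by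
  have key : ∀ K : ℝ≥0, 1 < K → ∀ A : Set (Metric.sphere (0 : E) 1), MeasurableSet A →
      (volume : Measure E).toSphere A ≤ (K : ℝ≥0∞) ^ n * μH[n] (Subtype.val '' A) := by
    intro K hK A hA
    have hloc : ∀ x : Metric.sphere (0 : E) 1, ∃ V ∈ 𝓝 x, ∀ B ⊆ V, MeasurableSet B →
        (volume : Measure E).toSphere B ≤ (K : ℝ≥0∞) ^ n * μH[n] (Subtype.val '' B) := by
      rintro ⟨e, he⟩
      obtain ⟨b, rfl⟩ := exists_orthonormalBasis_zero_eq hE (mem_sphere_zero_iff_norm.1 he)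
      obtain ⟨U, hU, hle⟩ := exists_nhds_volume_cone_le b hK
      refine ⟨Subtype.val ⁻¹' U, continuousAt_subtype_val hU, fun B hB hBm => ?_⟩
      rw [Measure.toSphere_apply' _ hBm, hE, Nat.cast_add_one]
      refine hle _ ?_
      rintro _ ⟨x, hx, rfl⟩
      exact ⟨hB hx, x.2⟩
    choose V hV hVle using hloc
    obtain ⟨t, htc, htU⟩ := TopologicalSpace.countable_cover_nhds
      (f := fun x => interior (V x)) fun x => interior_mem_nhds.2 (hV x)
    rcases t.eq_empty_or_nonempty with rfl | htne
    · have hA0 : A = ∅ := by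
        rw [Set.biUnion_empty] at htU
        rw [← Set.subset_empty_iff, htU]
        exact A.subset_univ
      simp [hA0]
    obtain ⟨f, rfl⟩ := htc.exists_eq_range htne
    set D : ℕ → Set (Metric.sphere (0 : E) 1) := disjointed fun i => interior (V (f i)) with hD
    have hDm : ∀ i, MeasurableSet (D i) :=
      MeasurableSet.disjointed fun i => isOpen_interior.measurableSet
    have hDU : ⋃ i, D i = Set.univ := by
      rw [hD, iUnion_disjointed, ← htU, Set.biUnion_range]
    have hAU : A = ⋃ i, A ∩ D i := by rw [← Set.inter_iUnion, hDU, Set.inter_univ]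
    have hemb : MeasurableEmbedding (Subtype.val : Metric.sphere (0 : E) 1 → E) :=
      MeasurableEmbedding.subtype_coe Metric.isClosed_sphere.measurableSet
    calc (volume : Measure E).toSphere A
        ≤ ∑' i, (volume : Measure E).toSphere (A ∩ D i) := by
          conv_lhs => rw [hAU]
          exact measure_iUnion_le _
      _ ≤ ∑' i, (K : ℝ≥0∞) ^ n * μH[n] (Subtype.val '' (A ∩ D i)) :=
          ENNReal.tsum_le_tsum fun i => hVle (f i) _ (Set.inter_subset_right.trans
            ((disjointed_subset _ i).trans interior_subset)) (hA.inter (hDm i))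
      _ = (K : ℝ≥0∞) ^ n * μH[n] (Subtype.val '' A) := by
          rw [ENNReal.tsum_mul_left, ← measure_iUnion, ← Set.image_iUnion, ← hAU]
          · intro i j hij
            exact (Set.disjoint_image_iff Subtype.val_injective).2
              (((disjoint_disjointed _) hij).mono Set.inter_subset_right Set.inter_subset_right)
          · exact fun i => hemb.measurableSet_image.2 (hA.inter (hDm i))
  refine Measure.le_iff.2 fun s hs => ?_
  have hsm := measurable_subtype_coe (p := (· ∈ Metric.sphere (0 : E) 1)) hs
  rw [Measure.map_apply measurable_subtype_coe hs, Measure.restrict_apply hs]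
  have hlim : Tendsto (fun K : ℝ≥0 => (K : ℝ≥0∞) ^ n *
      μH[n] (Subtype.val '' (Subtype.val ⁻¹' s : Set (Metric.sphere (0 : E) 1)))) (𝓝[>] 1)
      (𝓝 (1 * μH[n] (Subtype.val '' (Subtype.val ⁻¹' s : Set (Metric.sphere (0 : E) 1))))) := by
    refine ENNReal.Tendsto.mul_const ?_ (Or.inl one_ne_zero)
    have h : Continuous fun K : ℝ≥0 => (K : ℝ≥0∞) ^ n := by fun_prop
    simpa using (h.tendsto 1).mono_left nhdsWithin_le_nhds
  have h := ge_of_tendsto hlim (eventually_nhdsWithin_of_forall fun K hK => key K hK _ hsm)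
  rwa [one_mul, Subtype.image_preimage_coe, Set.inter_comm] at h

end Sphere

section Polar

variable {E : Type*} [NormedAddCommGroup E] [InnerProductSpace ℝ E] [FiniteDimensional ℝ E]
  [MeasurableSpace E] [BorelSpace E] {n : ℕ}

theorem integrable_and_setIntegral_annulus_eq (hE : Module.finrank ℝ E = n + 1) {r R : ℝ}
    (hr : 0 < r) (hrR : r ≤ R) {g : E → ℝ} (hg : Continuous g) :
    Integrable (fun w : Metric.sphere (0 : E) 1 => ∫ ρ in r..R, ρ ^ n * g (ρ • (w : E)))
        (volume : Measure E).toSphere ∧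
      ∫ x in {x : E | r ≤ ‖x‖ ∧ ‖x‖ ≤ R}, g x =
        ∫ w : Metric.sphere (0 : E) 1, (∫ ρ in r..R, ρ ^ n * g (ρ • (w : E)))
          ∂(volume : Measure E).toSphere := by
  have hnt : Nontrivial E := Module.nontrivial_of_finrank_pos (R := ℝ) (by omega)
  have := FiniteDimensional.proper_real E
  set Ω : Set E := {x : E | r ≤ ‖x‖ ∧ ‖x‖ ≤ R} with hΩ
  have hΩc : IsClosed Ω :=
    (isClosed_le continuous_const continuous_norm).inter
      (isClosed_le continuous_norm continuous_const)
  have hΩK : IsCompact Ω := by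
    refine (isCompact_closedBall (0 : E) R).of_isClosed_subset hΩc fun x hx => ?_
    simpa using hx.2
  have hmp := (volume : Measure E).measurePreserving_homeomorphUnitSphereProd
  rw [hE, Nat.add_sub_cancel] at hmp
  have hemb := (homeomorphUnitSphereProd E).measurableEmbedding
  set h : E → ℝ := Ω.indicator g with hh
  have hint : Integrable h := (hg.continuousOn.integrableOn_compact hΩK).integrable_indicator
    hΩc.measurableSet
  set H : Metric.sphere (0 : E) 1 × Set.Ioi (0 : ℝ) → ℝ :=
    fun p => h ((p.2 : ℝ) • (p.1 : E)) with hH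
  have hcomp : ∀ x : ({0}ᶜ : Set E), H (homeomorphUnitSphereProd E x) = h x := by
    intro x
    have hx : ‖(x : E)‖ ≠ 0 := norm_ne_zero_iff.2 x.2
    simp [hH, smul_smul, hx]
  have hHint : Integrable H ((volume : Measure E).toSphere.prod (Measure.volumeIoiPow n)) := by
    rw [← hmp.integrable_comp_emb hemb]
    have h1 : H ∘ homeomorphUnitSphereProd E = fun x : ({0}ᶜ : Set E) => h x := funext hcomp
    rw [h1]
    exact (integrableOn_iff_comap_subtypeVal (measurableSet_singleton _).compl).1 hint.integrableOn
  have hinner : ∀ w : Metric.sphere (0 : E) 1,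
      ∫ ρ, H (w, ρ) ∂Measure.volumeIoiPow n = ∫ ρ in r..R, ρ ^ n * g (ρ • (w : E)) := by
    intro w
    have hw : ‖(w : E)‖ = 1 := mem_sphere_zero_iff_norm.1 w.2
    simp only [Measure.volumeIoiPow, ENNReal.ofReal]
    rw [integral_withDensity_eq_integral_smul (by fun_prop),
      integral_subtype_comap measurableSet_Ioi
        (fun a : ℝ => Real.toNNReal (a ^ n) • h (a • (w : E))),
      intervalIntegral.integral_of_le hrR, ← integral_Icc_eq_integral_Ioc]
    have hsub : Set.Icc r R ⊆ Set.Ioi 0 := fun x hx => hr.trans_le hx.1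
    rw [setIntegral_eq_of_subset_of_forall_sdiff_eq_zero measurableSet_Ioi hsub]
    · refine setIntegral_congr_fun measurableSet_Icc fun ρ hρ => ?_
      have hρ0 : 0 < ρ := hsub hρ
      have hmem : ρ • (w : E) ∈ Ω := by
        simpa [hΩ, norm_smul, hw, abs_of_pos hρ0] using hρ
      simp only [hh, Set.indicator_of_mem hmem, NNReal.smul_def,
        Real.coe_toNNReal _ (pow_nonneg hρ0.le n), smul_eq_mul]
    · rintro ρ ⟨hρ, hρ'⟩
      have hmem : ρ • (w : E) ∉ Ω := by
        simpa [hΩ, norm_smul, hw, abs_of_pos (Set.mem_Ioi.1 hρ)] using hρ'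
      simp [hh, Set.indicator_of_notMem hmem]
  refine ⟨by simpa only [hinner] using hHint.integral_prod_left, ?_⟩
  calc ∫ x in Ω, g x = ∫ x, h x := (integral_indicator hΩc.measurableSet).symm
    _ = ∫ x in ({0}ᶜ : Set E), h x := by rw [restrict_compl_singleton]
    _ = ∫ x : ({0}ᶜ : Set E), h x ∂(volume.comap Subtype.val) :=
        (integral_subtype_comap (measurableSet_singleton _).compl h).symm
    _ = ∫ x : ({0}ᶜ : Set E), H (homeomorphUnitSphereProd E x) ∂(volume.comap Subtype.val) := by
        simp only [hcomp]
    _ = ∫ p, H p ∂((volume : Measure E).toSphere.prod (Measure.volumeIoiPow n)) :=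
        hmp.integral_comp hemb H
    _ = _ := by rw [integral_prod _ hHint]; simp only [hinner]

theorem integral_toSphere_le_setIntegral_sphere (hE : Module.finrank ℝ E = n + 1) {g : E → ℝ}
    (hg : Continuous g) (hg0 : ∀ x, 0 ≤ g x) :
    ∫ w : Metric.sphere (0 : E) 1, g w ∂(volume : Measure E).toSphere ≤
      ∫ w in Metric.sphere (0 : E) 1, g w ∂μH[n] := by
  have := FiniteDimensional.proper_real E
  obtain ⟨C, hC⟩ := (isCompact_sphere (0 : E) 1).exists_bound_of_continuousOn hg.continuousOn
  rw [← integral_map measurable_subtype_coe.aemeasurable hg.aestronglyMeasurable]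
  refine integral_mono_measure (toSphere_map_le hE) (ae_of_all _ hg0) ?_
  exact Measure.integrableOn_of_bounded (hausdorffMeasure_sphere_lt_top hE).ne
    hg.aestronglyMeasurable
    ((ae_restrict_mem Metric.isClosed_sphere.measurableSet).mono hC)

end Polar

theorem norm_apply_sq_le_sum {d : ℕ} {F : Type*} [NormedAddCommGroup F] [NormedSpace ℝ F]
    (L : EuclideanSpace ℝ (Fin d) →L[ℝ] F) (w : EuclideanSpace ℝ (Fin d)) :
    ‖L w‖ ^ 2 ≤ ‖w‖ ^ 2 * ∑ j : Fin d, ‖L (EuclideanSpace.single j 1)‖ ^ 2 := by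
  have hw : w = ∑ j, w j • EuclideanSpace.single j (1 : ℝ) := by
    simpa using ((EuclideanSpace.basisFun (Fin d) ℝ).sum_repr w).symm
  have h1 : ‖L w‖ ≤ ∑ j, |w j| * ‖L (EuclideanSpace.single j 1)‖ := by
    conv_lhs => rw [hw, map_sum]
    refine (norm_sum_le _ _).trans (le_of_eq ?_)
    simp [norm_smul]
  calc ‖L w‖ ^ 2 ≤ (∑ j, |w j| * ‖L (EuclideanSpace.single j 1)‖) ^ 2 := by gcongr
    _ ≤ (∑ j, |w j| ^ 2) * ∑ j, ‖L (EuclideanSpace.single j 1)‖ ^ 2 :=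
        Finset.sum_mul_sq_le_sq_mul_sq _ _ _
    _ = _ := by rw [EuclideanSpace.norm_sq_eq]; simp

theorem integral_ray_le {d n : ℕ} {r R ε : ℝ} (hr : 0 < r) (hrR : r < R) (hε : 0 < ε)
    {u : EuclideanSpace ℝ (Fin d) → ℂ} (hu : ContDiff ℝ 1 u) {w : EuclideanSpace ℝ (Fin d)}
    (hw : ‖w‖ = 1) :
    ∫ ρ in r..R, ρ ^ n * ‖u (ρ • w)‖ ^ 2 ≤
      (1 + ε) * (R / r) ^ n * ((R - r) ^ 2 / π ^ 2) *
          (∫ ρ in r..R, ρ ^ n * ∑ j : Fin d,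
            ‖fderiv ℝ u (ρ • w) (EuclideanSpace.single j 1)‖ ^ 2) +
        (1 + ε⁻¹) * R ^ n * (R - r) * (‖u (r • w)‖ ^ 2 + ‖u (R • w)‖ ^ 2) := by
  have hR : 0 < R := hr.trans hrR
  have huc : Continuous u := hu.continuous
  have hduc : Continuous (fderiv ℝ u) := hu.continuous_fderiv one_ne_zero
  have hder : ∀ ρ : ℝ, HasDerivAt (fun ρ : ℝ => u (ρ • w)) (fderiv ℝ u (ρ • w) w) ρ := by
    intro ρ
    have h1 : HasDerivAt (fun ρ : ℝ => ρ • w) w ρ := by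
      simpa using (hasDerivAt_id ρ).smul_const w
    exact (hu.differentiable one_ne_zero _).hasFDerivAt.comp_hasDerivAt ρ h1
  have h1 := integral_norm_sq_le_add hrR hε hder (by fun_prop)
  have h2 : ∫ ρ in r..R, ρ ^ n * ‖u (ρ • w)‖ ^ 2 ≤ R ^ n * ∫ ρ in r..R, ‖u (ρ • w)‖ ^ 2 := by
    rw [← intervalIntegral.integral_const_mul]
    refine intervalIntegral.integral_mono_on hrR.le
      (Continuous.intervalIntegrable (by fun_prop) _ _)
      (Continuous.intervalIntegrable (by fun_prop) _ _) fun ρ hρ => ?_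
    have := hr.le.trans hρ.1
    have := hρ.2
    gcongr
  have h3 : r ^ n * ∫ ρ in r..R, ‖fderiv ℝ u (ρ • w) w‖ ^ 2 ≤
      ∫ ρ in r..R, ρ ^ n * ∑ j : Fin d,
        ‖fderiv ℝ u (ρ • w) (EuclideanSpace.single j 1)‖ ^ 2 := by
    rw [← intervalIntegral.integral_const_mul]
    refine intervalIntegral.integral_mono_on hrR.le
      (Continuous.intervalIntegrable (by fun_prop) _ _)
      (Continuous.intervalIntegrable (by fun_prop) _ _) fun ρ hρ => ?_
    have h4 := norm_apply_sq_le_sum (fderiv ℝ u (ρ • w)) w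
    rw [hw, one_pow, one_mul] at h4
    have := hr.le.trans hρ.1
    have := hρ.1
    gcongr
  rw [← le_div_iff₀' (by positivity)] at h3
  calc _ ≤ _ := h2
    _ ≤ R ^ n * _ := mul_le_mul_of_nonneg_left h1 (by positivity)
    _ ≤ R ^ n * ((1 + ε) * ((R - r) ^ 2 / π ^ 2) * ((∫ ρ in r..R, ρ ^ n * ∑ j : Fin d,
            ‖fderiv ℝ u (ρ • w) (EuclideanSpace.single j 1)‖ ^ 2) / r ^ n) +
          (1 + ε⁻¹) * (R - r) * (‖u (r • w)‖ ^ 2 + ‖u (R • w)‖ ^ 2)) := by gcongr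
    _ = _ := by rw [div_pow]; ring

/-- Claim 1: a Poincaré–Wirtinger inequality on the annulus
`Ω = {r ≤ |x| ≤ R} ⊂ ℝ^d`, with boundary terms given by surface integrals over the
spheres of radii `r` and `R` (written as integrals over the unit sphere, w.r.t. the
`(d−1)`-dimensional Hausdorff measure). -/
theorem annulus_poincare (d : ℕ) (hd : 2 ≤ d) (r R : ℝ) (hr : 0 < r) (hrR : r < R)
    (u : EuclideanSpace ℝ (Fin d) → ℂ) (hu : ContDiff ℝ 1 u) :
    ∀ ε : ℝ, 0 < ε →
      (∫ x in {x : EuclideanSpace ℝ (Fin d) | r ≤ ‖x‖ ∧ ‖x‖ ≤ R}, ‖u x‖ ^ 2) ≤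
        (1 + ε) * (R / r) ^ (d - 1) * ((R - r) ^ 2 / π ^ 2) *
            (∫ x in {x : EuclideanSpace ℝ (Fin d) | r ≤ ‖x‖ ∧ ‖x‖ ≤ R},
              ∑ j : Fin d, ‖fderiv ℝ u x (EuclideanSpace.single j 1)‖ ^ 2) +
          (1 + ε⁻¹) * R ^ (d - 1) * (R - r) *
            ((∫ w in Metric.sphere (0 : EuclideanSpace ℝ (Fin d)) 1, ‖u (r • w)‖ ^ 2
                ∂(μH[(d : ℝ) - 1])) +
              ∫ w in Metric.sphere (0 : EuclideanSpace ℝ (Fin d)) 1, ‖u (R • w)‖ ^ 2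
                ∂(μH[(d : ℝ) - 1])) := by
  intro ε hε
  obtain ⟨n, rfl⟩ : ∃ n, d = n + 1 := ⟨d - 1, by omega⟩
  have hE : Module.finrank ℝ (EuclideanSpace ℝ (Fin (n + 1))) = n + 1 := finrank_euclideanSpace_fin
  have hdim : ((n + 1 : ℕ) : ℝ) - 1 = n := by simp
  rw [hdim, Nat.add_sub_cancel]
  have huc : Continuous u := hu.continuous
  have hduc : Continuous (fderiv ℝ u) := hu.continuous_fderiv one_ne_zero
  obtain ⟨hi1, he1⟩ := integrable_and_setIntegral_annulus_eq hE hr hrR.le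
    (g := fun x => ‖u x‖ ^ 2) (by fun_prop)
  obtain ⟨hi2, he2⟩ := integrable_and_setIntegral_annulus_eq hE hr hrR.le
    (g := fun x => ∑ j : Fin (n + 1), ‖fderiv ℝ u x (EuclideanSpace.single j 1)‖ ^ 2)
    (by fun_prop)
  have hbd : ∀ t : ℝ, Continuous fun w : EuclideanSpace ℝ (Fin (n + 1)) => ‖u (t • w)‖ ^ 2 :=
    fun t => by fun_prop
  have hbi : ∀ t : ℝ, Integrable
      (fun w : Metric.sphere (0 : EuclideanSpace ℝ (Fin (n + 1))) 1 =>
        ‖u (t • (w : EuclideanSpace ℝ (Fin (n + 1))))‖ ^ 2)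
      (volume : Measure (EuclideanSpace ℝ (Fin (n + 1)))).toSphere := fun t =>
    ((hbd t).comp continuous_subtype_val).integrable_of_hasCompactSupport
      (HasCompactSupport.of_compactSpace _)
  have hb : ∀ t : ℝ, _ := fun t => integral_toSphere_le_setIntegral_sphere hE (hbd t)
    fun _ => by positivity
  have hbs : Integrable (fun w : Metric.sphere (0 : EuclideanSpace ℝ (Fin (n + 1))) 1 =>
      ‖u (r • (w : EuclideanSpace ℝ (Fin (n + 1))))‖ ^ 2 +
        ‖u (R • (w : EuclideanSpace ℝ (Fin (n + 1))))‖ ^ 2)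
      (volume : Measure (EuclideanSpace ℝ (Fin (n + 1)))).toSphere := (hbi r).add (hbi R)
  rw [he1, he2]
  refine (integral_mono hi1 ((hi2.const_mul _).add (hbs.const_mul _))
    fun w => integral_ray_le hr hrR hε hu (mem_sphere_zero_iff_norm.1 w.2)).trans ?_
  simp only [Pi.add_apply]
  rw [integral_add (hi2.const_mul _) (hbs.const_mul _),
    integral_const_mul, integral_const_mul, integral_add (hbi r) (hbi R)]
  have hR := hr.trans hrR
  have hL := sub_pos.2 hrR
  exact add_le_add le_rfl (mul_le_mul_of_nonneg_left (add_le_add (hb r) (hb R)) (by positivity))
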